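/- In the attacked TCP system G_a with channels and with timeout peers (Peer A and Peer B with the additional transition listen−timeout_X→closed, four channels, and the attacked network), with uncontrollable events Σ_uc = Σ \ ATTK and observable events Σ_o = { m_C1N, m_C3N, m_NC2, m_NC4 : m ∈ {SYN, ACK, FIN, SYN_ACK} } with natural projection P, let M_TM1 = { s ∈ L(G_a) : the state reached after s has Peer A at 'closed' and Peer B at 'established' }. Then there exists a nonempty sublanguage K ⊆ M_TM1 that is controllable with respect to (L(G_a), Σ_uc) and normal with respect to (L(G_a), P); in particular the string SYN_BC3 · SYN_C3N · SYN_ACK_NC4 · SYN_ACK_C4B · ACK_BC3 belongs to M_TM1. Hence a For-all attack against Threat Model 1 exists in this setup. -/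

import Mathlib

/-! Model of TCP connection establishment with channels: Peer A, Peer B, four channels
C1–C4, and the attacked network, composed synchronously. -/

/-- Packet types. -/
inductive Pkt | syn | ack | fin | synack deriving DecidableEq

/-- Events: `ac1 m` = packet `m` from Peer A to Channel 1, `c1n m` = from Channel 1 to
the network, `nc2 m` = from the network to Channel 2, `c2a m` = from Channel 2 to
Peer A; similarly `bc3`, `c3n`, `nc4`, `c4b` on Peer B's side; plus private events. -/
inductive Ev
  | ac1 : Pkt → Ev
  | c1n : Pkt → Ev
  | nc2 : Pkt → Ev
  | c2a : Pkt → Ev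
  | bc3 : Pkt → Ev
  | c3n : Pkt → Ev
  | nc4 : Pkt → Ev
  | c4b : Pkt → Ev
  | listenA | listenB | timeoutA | timeoutB | delA | delB
  deriving DecidableEq

/-- TCP peer states. -/
inductive PSt
  | closed | synsent | listen | i0 | i1 | i2 | established | synreceived | i3
  | closewait | lastack | finwait1 | finwait2 | i4 | i5 | closing | timewait
  deriving DecidableEq

/-- TCP peer transitions (with timeout), parametrized by the peer's send events
`snd`, receive events `rcv`, and private events `lst`, `tmo`, `del`. -/
def peerTrans (snd rcv : Pkt → Ev) (lst tmo del : Ev) : List (PSt × Ev × PSt) :=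
  [(.closed, snd .syn, .synsent), (.synsent, rcv .synack, .i0), (.i0, snd .ack, .established),
   (.synsent, rcv .syn, .i1), (.i1, snd .ack, .synreceived),
   (.synreceived, rcv .ack, .established),
   (.closed, lst, .listen), (.listen, tmo, .closed), (.listen, rcv .syn, .i2),
   (.i2, snd .synack, .synreceived),
   (.established, rcv .fin, .i3), (.i3, snd .ack, .closewait),
   (.closewait, snd .fin, .lastack), (.lastack, rcv .ack, .closed),
   (.established, snd .fin, .finwait1), (.finwait1, rcv .ack, .finwait2),
   (.finwait1, rcv .fin, .i4), (.finwait2, rcv .fin, .i5),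
   (.i4, snd .ack, .closing), (.closing, rcv .ack, .closed),
   (.i5, snd .ack, .timewait), (.timewait, del, .closed)]

/-- A peer's alphabet. -/
def peerAlph (snd rcv : Pkt → Ev) (lst tmo del : Ev) (e : Ev) : Prop :=
  (∃ m, e = snd m) ∨ (∃ m, e = rcv m) ∨ e = lst ∨ e = tmo ∨ e = del

/-- Peer A: sends `ac1 m`, receives `c2a m`. -/
def peerAStep (q : PSt) (e : Ev) (q' : PSt) : Prop :=
  (q, e, q') ∈ peerTrans Ev.ac1 Ev.c2a .listenA .timeoutA .delA
def peerAAlph : Ev → Prop := peerAlph Ev.ac1 Ev.c2a .listenA .timeoutA .delA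

/-- Peer B: sends `bc3 m`, receives `c4b m`. -/
def peerBStep (q : PSt) (e : Ev) (q' : PSt) : Prop :=
  (q, e, q') ∈ peerTrans Ev.bc3 Ev.c4b .listenB .timeoutB .delB
def peerBAlph : Ev → Prop := peerAlph Ev.bc3 Ev.c4b .listenB .timeoutB .delB

/-- One-place channel: state `none` (empty) or `some m` (holding packet `m`). -/
def chanStep (inp out : Pkt → Ev) (q : Option Pkt) (e : Ev) (q' : Option Pkt) : Prop :=
  (∃ m, q = none ∧ e = inp m ∧ q' = some m) ∨ (∃ m, q = some m ∧ e = out m ∧ q' = none)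
def chanAlph (inp out : Pkt → Ev) (e : Ev) : Prop := (∃ m, e = inp m) ∨ (∃ m, e = out m)

/-- Network states: `init`, plus a state `qa m` / `qb m` per packet in transit. -/
inductive NSt | init | qa : Pkt → NSt | qb : Pkt → NSt
  deriving DecidableEq

/-- The network alphabet. -/
def netAlph (e : Ev) : Prop :=
  (∃ m, e = Ev.c1n m) ∨ (∃ m, e = Ev.c3n m) ∨ (∃ m, e = Ev.nc2 m) ∨ (∃ m, e = Ev.nc4 m)

/-- The attacker's controllable events: the outgoing packets of the network. -/
def ATTK : Set Ev := {e | ∃ m, e = Ev.nc2 m ∨ e = Ev.nc4 m}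

/-- Attacked network transitions: from any non-initial state the attacker may emit any
event of `ATTK`. -/
def netTransAtk (q : NSt) (e : Ev) (q' : NSt) : Prop :=
  (∃ m, q = .init ∧ e = .c1n m ∧ q' = .qa m) ∨
  (∃ m, q = .init ∧ e = .c3n m ∧ q' = .qb m) ∨
  ((∃ m, q = .qa m ∨ q = .qb m) ∧ e ∈ ATTK ∧ q' = .init)

/-- Synchronization of one component: if the event is in the component's alphabet, the
component must execute a transition on it; otherwise the component does not move. -/
def sync {Q : Type*} (alph : Ev → Prop) (trans : Q → Ev → Q → Prop)
    (q : Q) (e : Ev) (q' : Q) : Prop :=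
  (alph e ∧ trans q e q') ∨ (¬ alph e ∧ q' = q)

/-- Global states of the TCP system with channels. -/
structure GSt where
  pa : PSt
  pb : PSt
  c1 : Option Pkt
  c2 : Option Pkt
  c3 : Option Pkt
  c4 : Option Pkt
  net : NSt
  deriving DecidableEq

/-- Global step of the synchronous composition `G_a` (attacked network). -/
def gstep (q : GSt) (e : Ev) (q' : GSt) : Prop :=
  sync peerAAlph peerAStep q.pa e q'.pa ∧
  sync peerBAlph peerBStep q.pb e q'.pb ∧
  sync (chanAlph Ev.ac1 Ev.c1n) (chanStep Ev.ac1 Ev.c1n) q.c1 e q'.c1 ∧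
  sync (chanAlph Ev.nc2 Ev.c2a) (chanStep Ev.nc2 Ev.c2a) q.c2 e q'.c2 ∧
  sync (chanAlph Ev.bc3 Ev.c3n) (chanStep Ev.bc3 Ev.c3n) q.c3 e q'.c3 ∧
  sync (chanAlph Ev.nc4 Ev.c4b) (chanStep Ev.nc4 Ev.c4b) q.c4 e q'.c4 ∧
  sync netAlph netTransAtk q.net e q'.net

/-- Runs of the composition. -/
inductive Reach (step : GSt → Ev → GSt → Prop) (q0 : GSt) : List Ev → GSt → Prop
  | nil : Reach step q0 [] q0
  | snoc {s : List Ev} {q : GSt} {e : Ev} {q' : GSt} :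
      Reach step q0 s q → step q e q' → Reach step q0 (s ++ [e]) q'

/-- Initial global state. -/
def init : GSt := ⟨.closed, .closed, none, none, none, none, .init⟩

/-- Generated language of `G_a`. -/
def Lang : Set (List Ev) := {s | ∃ q, Reach gstep init s q}

/-- Violation of Threat Model 1: strings after which Peer A is at `closed` while Peer B
is at `established`. -/
def MTM1 : Set (List Ev) :=
  {s | ∃ q : GSt, Reach gstep init s q ∧ q.pa = PSt.closed ∧ q.pb = PSt.established}

/-! Abstract supervisory-control notions on languages. -/

/-- Prefix closure `pr(K)`. -/
def prefixClosure {A : Type*} (K : Set (List A)) : Set (List A) := {s | ∃ t ∈ K, s <+: t}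

/-- Controllability of `K` w.r.t. `(L, Auc)`. -/
def IsControllable {A : Type*} (K L : Set (List A)) (Auc : Set A) : Prop :=
  ∀ s ∈ prefixClosure K, ∀ σ ∈ Auc, s ++ [σ] ∈ L → s ++ [σ] ∈ prefixClosure K

/-- Normality of `K` w.r.t. `(L, P)`: `pr(K) = P⁻¹(P(pr(K))) ∩ L`. -/
def IsNormalLang {A : Type*} (K L : Set (List A)) (P : List A → List A) : Prop :=
  prefixClosure K = {s | ∃ t ∈ prefixClosure K, P s = P t} ∩ L

/-- Natural projection onto the attacker's observable events
`Eo = { m_C1N, m_C3N, m_NC2, m_NC4 }`. -/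
def P (s : List Ev) : List Ev :=
  s.filter (fun e => match e with
    | .c1n _ => true | .c3n _ => true | .nc2 _ => true | .nc4 _ => true
    | _ => false)

/-! The attack returns every packet to its sender. Each peer then runs alone through a
simultaneous open followed by a simultaneous close, and from every reachable state it can be
brought to `closed` and to `established` without involving the other peer. -/

/-- The echoing supervisor: it tracks the state of the network and permits a packet to be
emitted only towards the peer that sent it. -/
def echoStep : NSt → Ev → Option NSt
  | _, .c1n m => some (.qa m)
  | _, .c3n m => some (.qb m)
  | n, .nc2 m => if n = .qa m then some .init else none
  | n, .nc4 m => if n = .qb m then some .init else none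
  | n, _ => some n

/-- The state of the echoing supervisor after a string, if it permits that string. -/
def echoRun (s : List Ev) : Option NSt := s.foldlM echoStep .init

theorem echoRun_nil : echoRun [] = some .init := rfl

theorem echoRun_append (s t : List Ev) :
    echoRun (s ++ t) = (echoRun s).bind fun n => t.foldlM echoStep n := by
  simp [echoRun, List.foldlM_append]

theorem echoRun_snoc (s : List Ev) (e : Ev) :
    echoRun (s ++ [e]) = (echoRun s).bind fun n => echoStep n e := by
  simp [echoRun_append]

theorem foldlM_echoStep_P (s : List Ev) (n : NSt) :
    (P s).foldlM echoStep n = s.foldlM echoStep n := by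
  induction s generalizing n with
  | nil => rfl
  | cons e s ih =>
    have ih' : ∀ n, (P s).foldlM echoStep n = s.foldlM echoStep n := ih
    unfold P at ih' ⊢
    cases e <;> simp [echoStep, ih']

theorem echoRun_P (s : List Ev) : echoRun (P s) = echoRun s := foldlM_echoStep_P s .init

theorem echoStep_of_notMem_ATTK {e : Ev} (he : e ∉ ATTK) (n : NSt) :
    ∃ n', echoStep n e = some n' := by
  cases e <;> simp_all [echoStep, ATTK]

theorem echoStep_eq_net {q q' : GSt} {e : Ev} {n : NSt} (h : gstep q e q')
    (hn : echoStep q.net e = some n) : n = q'.net := by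
  obtain ⟨-, -, -, -, -, -, h⟩ := h
  cases e <;> simp_all [echoStep, sync, netAlph, netTransAtk, ATTK]

/-- Peer states without an outstanding packet that occur under the echo attack. -/
inductive Idle : PSt → Prop
  | closed : Idle .closed
  | listen : Idle .listen
  | i1 : Idle .i1
  | established : Idle .established
  | i4 : Idle .i4

/-- Peer states that wait for the echo of a packet. -/
inductive Awaits : PSt → Pkt → Prop
  | synsent : Awaits .synsent .syn
  | synreceived : Awaits .synreceived .ack
  | finwait1 : Awaits .finwait1 .fin
  | closing : Awaits .closing .ack

/-- Configurations of a peer, its outgoing channel, the packet of that peer held by the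
network, and its incoming channel that occur under the echo attack. -/
inductive EchoConf : PSt → Option Pkt → Option Pkt → Option Pkt → Prop
  | idle {p} : Idle p → EchoConf p none none none
  | out {p m} : Awaits p m → EchoConf p (some m) none none
  | net {p m} : Awaits p m → EchoConf p none (some m) none
  | inc {p m} : Awaits p m → EchoConf p none none (some m)

/-- The packet of Peer A held by the network. -/
def NSt.ofA : NSt → Option Pkt
  | .qa m => some m
  | _ => none

/-- The packet of Peer B held by the network. -/
def NSt.ofB : NSt → Option Pkt
  | .qb m => some m
  | _ => none

/-- The global invariant of the echo attack. -/
def EchoInv (q : GSt) : Prop :=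
  EchoConf q.pa q.c1 q.net.ofA q.c2 ∧ EchoConf q.pb q.c3 q.net.ofB q.c4

attribute [local simp] gstep sync peerAAlph peerBAlph peerAlph chanAlph chanStep netAlph
  netTransAtk ATTK peerAStep peerBStep peerTrans

theorem EchoInv.step {q q' : GSt} {e : Ev} (hq : EchoInv q) (h : gstep q e q')
    (he : echoStep q.net e = some q'.net) : EchoInv q' := by
  obtain ⟨pa, pb, c1, c2, c3, c4, n⟩ := q
  obtain ⟨pa', pb', c1', c2', c3', c4', n'⟩ := q'
  obtain ⟨hA, hB⟩ := hq
  cases e <;>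
    simp at h <;>
    simp [echoStep] at he hA hB <;>
    grind (splits := 30) [EchoInv, NSt.ofA, NSt.ofB, EchoConf, Idle, Awaits, cases Idle,
      cases Awaits]

theorem echoRun_eq_net {s : List Ev} {q : GSt} (h : Reach gstep init s q) {n : NSt}
    (hn : echoRun s = some n) : n = q.net ∧ EchoInv q := by
  induction h generalizing n with
  | nil =>
    cases hn
    exact ⟨rfl, .idle .closed, .idle .closed⟩
  | @snoc s q e q' _ hstep ih =>
    rw [echoRun_snoc, Option.bind_eq_some_iff] at hn
    obtain ⟨k, hk, hn⟩ := hn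
    obtain ⟨rfl, hinv⟩ := ih hk
    obtain rfl := echoStep_eq_net hstep hn
    exact ⟨rfl, hinv.step hstep hn⟩

/-- Steps of the composition that the echoing supervisor permits. -/
def EchoMove (q r : GSt) : Prop := ∃ e, gstep q e r ∧ echoStep q.net e = some r.net

open Relation in
theorem exists_echoRun_of_moves {q q' : GSt} (h : ReflTransGen EchoMove q q') {s : List Ev}
    (hs : Reach gstep init s q) (hn : echoRun s = some q.net) :
    ∃ t, s <+: t ∧ Reach gstep init t q' ∧ echoRun t = some q'.net := by
  induction h with
  | refl => exact ⟨s, List.prefix_rfl, hs, hn⟩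
  | tail _ hmove ih =>
    obtain ⟨t, hst, ht, htn⟩ := ih
    obtain ⟨e, hstep, he⟩ := hmove
    exact ⟨t ++ [e], hst.trans (List.prefix_append t [e]), ht.snoc hstep,
      by rw [echoRun_snoc, htn, Option.bind_some, he]⟩

/-- Moves of a peer together with its outgoing and incoming channel under the echo attack,
where the network is in its initial state before and after each move. -/
inductive PeerMove : PSt × Option Pkt × Option Pkt → PSt × Option Pkt × Option Pkt → Prop
  | timeout : PeerMove (.listen, none, none) (.closed, none, none)
  | open_syn : PeerMove (.closed, none, none) (.synsent, some .syn, none)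
  | open_ack : PeerMove (.i1, none, none) (.synreceived, some .ack, none)
  | close_fin : PeerMove (.established, none, none) (.finwait1, some .fin, none)
  | close_ack : PeerMove (.i4, none, none) (.closing, some .ack, none)
  | echo (p m) : PeerMove (p, some m, none) (p, none, some m)
  | rcv_syn : PeerMove (.synsent, none, some .syn) (.i1, none, none)
  | rcv_open_ack : PeerMove (.synreceived, none, some .ack) (.established, none, none)
  | rcv_fin : PeerMove (.finwait1, none, some .fin) (.i4, none, none)
  | rcv_close_ack : PeerMove (.closing, none, some .ack) (.closed, none, none)

open Relation in
theorem EchoConf.moves_closed_established {p : PSt} {o i : Option Pkt}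
    (h : EchoConf p o none i) :
    ReflTransGen PeerMove (p, o, i) (.closed, none, none) ∧
      ReflTransGen PeerMove (p, o, i) (.established, none, none) := by
  have h1 := ReflTransGen.single PeerMove.rcv_close_ack
  have h2 := h1.head (.echo _ _)
  have h3 := h2.head .close_ack
  have h4 := h3.head .rcv_fin
  have h5 := h4.head (.echo _ _)
  have h6 := h5.head .close_fin
  have k1 := ReflTransGen.single PeerMove.rcv_open_ack
  have k2 := k1.head (.echo _ _)
  have k3 := k2.head .open_ack
  have k4 := k3.head .rcv_syn
  have k5 := k4.head (.echo _ _)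
  have k6 := k5.head .open_syn
  have k7 := k6.head .timeout
  have key : ReflTransGen PeerMove (p, o, i) (.closed, none, none) ∨
      ReflTransGen PeerMove (p, o, i) (.established, none, none) := by
    cases h with
    | idle h => cases h <;> first | exact .inr ‹_› | exact .inl ‹_›
    | out h => cases h <;> first | exact .inr ‹_› | exact .inl ‹_›
    | inc h => cases h <;> first | exact .inr ‹_› | exact .inl ‹_›
  exact key.elim (fun h => ⟨h, h.trans k6⟩) fun h => ⟨h.trans h6, h⟩

open Relation in
theorem moves_of_peerMove_A {x y : PSt × Option Pkt × Option Pkt} (h : PeerMove x y)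
    (pb : PSt) (c3 c4 : Option Pkt) :
    ReflTransGen EchoMove ⟨x.1, pb, x.2.1, x.2.2, c3, c4, .init⟩
      ⟨y.1, pb, y.2.1, y.2.2, c3, c4, .init⟩ := by
  have single {q q' : GSt} (e : Ev) (hg : gstep q e q') (he : echoStep q.net e = some q'.net) :
      ReflTransGen EchoMove q q' := .single ⟨e, hg, he⟩
  cases h with
  | timeout => refine single .timeoutA ?_ rfl; simp
  | open_syn => refine single (.ac1 .syn) ?_ rfl; simp
  | open_ack => refine single (.ac1 .ack) ?_ rfl; simp
  | close_fin => refine single (.ac1 .fin) ?_ rfl; simp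
  | close_ack => refine single (.ac1 .ack) ?_ rfl; simp
  | echo p m =>
    refine (single (q' := ⟨p, pb, none, none, c3, c4, .qa m⟩) (.c1n m) ?_ rfl).trans
      (single (.nc2 m) ?_ (by simp [echoStep])) <;> simp
  | rcv_syn => refine single (.c2a .syn) ?_ rfl; simp
  | rcv_open_ack => refine single (.c2a .ack) ?_ rfl; simp
  | rcv_fin => refine single (.c2a .fin) ?_ rfl; simp
  | rcv_close_ack => refine single (.c2a .ack) ?_ rfl; simp

open Relation in
theorem moves_of_peerMove_B {x y : PSt × Option Pkt × Option Pkt} (h : PeerMove x y)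
    (pa : PSt) (c1 c2 : Option Pkt) :
    ReflTransGen EchoMove ⟨pa, x.1, c1, c2, x.2.1, x.2.2, .init⟩
      ⟨pa, y.1, c1, c2, y.2.1, y.2.2, .init⟩ := by
  have single {q q' : GSt} (e : Ev) (hg : gstep q e q') (he : echoStep q.net e = some q'.net) :
      ReflTransGen EchoMove q q' := .single ⟨e, hg, he⟩
  cases h with
  | timeout => refine single .timeoutB ?_ rfl; simp
  | open_syn => refine single (.bc3 .syn) ?_ rfl; simp
  | open_ack => refine single (.bc3 .ack) ?_ rfl; simp
  | close_fin => refine single (.bc3 .fin) ?_ rfl; simp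
  | close_ack => refine single (.bc3 .ack) ?_ rfl; simp
  | echo p m =>
    refine (single (q' := ⟨pa, p, c1, c2, none, none, .qb m⟩) (.c3n m) ?_ rfl).trans
      (single (.nc4 m) ?_ (by simp [echoStep])) <;> simp
  | rcv_syn => refine single (.c4b .syn) ?_ rfl; simp
  | rcv_open_ack => refine single (.c4b .ack) ?_ rfl; simp
  | rcv_fin => refine single (.c4b .fin) ?_ rfl; simp
  | rcv_close_ack => refine single (.c4b .ack) ?_ rfl; simp

open Relation in
theorem EchoInv.moves_of_net_init {q : GSt} (h : EchoInv q) (hn : q.net = .init) :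
    ReflTransGen EchoMove q ⟨.closed, .established, none, none, none, none, .init⟩ := by
  obtain ⟨pa, pb, c1, c2, c3, c4, n⟩ := q
  obtain rfl : n = .init := hn
  obtain ⟨hA, hB⟩ := h
  have hA' := hA.moves_closed_established.1.lift'
    (fun x => (⟨x.1, pb, x.2.1, x.2.2, c3, c4, .init⟩ : GSt))
    fun _ _ h => moves_of_peerMove_A h pb c3 c4
  have hB' := hB.moves_closed_established.2.lift'
    (fun x => (⟨.closed, x.1, none, none, x.2.1, x.2.2, .init⟩ : GSt))
    fun _ _ h => moves_of_peerMove_B h .closed none none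
  exact hA'.trans hB'

open Relation in
theorem EchoInv.moves {q : GSt} (h : EchoInv q) :
    ReflTransGen EchoMove q ⟨.closed, .established, none, none, none, none, .init⟩ := by
  obtain ⟨pa, pb, c1, c2, c3, c4, n⟩ := q
  cases n with
  | init => exact h.moves_of_net_init rfl
  | qa m =>
    have hc : c2 = none := by
      have hA : EchoConf pa c1 (some m) c2 := h.1
      cases hA; rfl
    subst hc
    have hmove : gstep ⟨pa, pb, c1, none, c3, c4, .qa m⟩ (.nc2 m)
        ⟨pa, pb, c1, some m, c3, c4, .init⟩ := by simp
    have he : echoStep (.qa m) (.nc2 m) = some .init := by simp [echoStep]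
    exact .head ⟨_, hmove, he⟩ ((h.step hmove he).moves_of_net_init rfl)
  | qb m =>
    have hc : c4 = none := by
      have hB : EchoConf pb c3 (some m) c4 := h.2
      cases hB; rfl
    subst hc
    have hmove : gstep ⟨pa, pb, c1, c2, c3, none, .qb m⟩ (.nc4 m)
        ⟨pa, pb, c1, c2, c3, some m, .init⟩ := by simp
    have he : echoStep (.qb m) (.nc4 m) = some .init := by simp [echoStep]
    exact .head ⟨_, hmove, he⟩ ((h.step hmove he).moves_of_net_init rfl)

/-- The language of the echo attack. -/
def echoLang : Set (List Ev) := {s | s ∈ MTM1 ∧ ∃ n, echoRun s = some n}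

theorem mem_Lang_of_append {s : List Ev} (t : List Ev) {q : GSt}
    (h : Reach gstep init (s ++ t) q) : s ∈ Lang := by
  induction t using List.reverseRecOn generalizing q with
  | nil => exact ⟨q, by simpa using h⟩
  | append_singleton t e ih =>
    rw [← List.append_assoc] at h
    generalize hu : s ++ t ++ [e] = u at h
    cases h with
    | nil => simp at hu
    | snoc h _ =>
      obtain ⟨rfl, -⟩ := List.append_inj' hu rfl
      exact ih h

theorem mem_prefixClosure_echoLang {s : List Ev} :
    s ∈ prefixClosure echoLang ↔ s ∈ Lang ∧ ∃ n, echoRun s = some n := by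
  constructor
  · rintro ⟨_, ⟨⟨q, hq, -⟩, n, hn⟩, t, rfl⟩
    refine ⟨mem_Lang_of_append t hq, ?_⟩
    rw [echoRun_append, Option.bind_eq_some_iff] at hn
    exact ⟨_, hn.choose_spec.1⟩
  · rintro ⟨⟨q, hq⟩, n, hn⟩
    obtain ⟨rfl, hinv⟩ := echoRun_eq_net hq hn
    obtain ⟨t, hst, ht, htn⟩ := exists_echoRun_of_moves hinv.moves hq hn
    exact ⟨t, ⟨⟨_, ht, rfl, rfl⟩, _, htn⟩, hst⟩

theorem echoLang_nonempty : echoLang.Nonempty := by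
  obtain ⟨t, ht, -⟩ : [] ∈ prefixClosure echoLang :=
    mem_prefixClosure_echoLang.2 ⟨⟨init, .nil⟩, _, echoRun_nil⟩
  exact ⟨t, ht⟩

theorem isControllable_echoLang : IsControllable echoLang Lang ATTKᶜ := by
  intro s hs e he hL
  obtain ⟨-, n, hn⟩ := mem_prefixClosure_echoLang.1 hs
  obtain ⟨n', hn'⟩ := echoStep_of_notMem_ATTK he n
  exact mem_prefixClosure_echoLang.2
    ⟨hL, n', by rw [echoRun_snoc, hn, Option.bind_some, hn']⟩

theorem isNormalLang_echoLang : IsNormalLang echoLang Lang P := by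
  ext s
  constructor
  · exact fun hs => ⟨⟨s, hs, rfl⟩, (mem_prefixClosure_echoLang.1 hs).1⟩
  · rintro ⟨⟨t, ht, hP⟩, hL⟩
    obtain ⟨-, n, hn⟩ := mem_prefixClosure_echoLang.1 ht
    exact mem_prefixClosure_echoLang.2
      ⟨hL, n, by rw [← echoRun_P, hP, echoRun_P, hn]⟩

theorem synack_injection_mem_MTM1 :
    ([.bc3 .syn, .c3n .syn, .nc4 .synack, .c4b .synack, .bc3 .ack] : List Ev) ∈ MTM1 := by
  have h1 : gstep init (.bc3 .syn)
      ⟨.closed, .synsent, none, none, some .syn, none, .init⟩ := by simp [init]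
  have h2 : gstep ⟨.closed, .synsent, none, none, some .syn, none, .init⟩ (.c3n .syn)
      ⟨.closed, .synsent, none, none, none, none, .qb .syn⟩ := by simp
  have h3 : gstep ⟨.closed, .synsent, none, none, none, none, .qb .syn⟩ (.nc4 .synack)
      ⟨.closed, .synsent, none, none, none, some .synack, .init⟩ := by simp
  have h4 : gstep ⟨.closed, .synsent, none, none, none, some .synack, .init⟩ (.c4b .synack)
      ⟨.closed, .i0, none, none, none, none, .init⟩ := by simp
  have h5 : gstep ⟨.closed, .i0, none, none, none, none, .init⟩ (.bc3 .ack)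
      ⟨.closed, .established, none, none, some .ack, none, .init⟩ := by simp
  exact ⟨_, ((((Reach.nil.snoc h1).snoc h2).snoc h3).snoc h4).snoc h5, rfl, rfl⟩

/-- with the timeout transitions restored, there exists a nonempty
sublanguage `K ⊆ M_TM1` that is controllable w.r.t. `(L(G_a), Σ \ ATTK)` and normal
w.r.t. `(L(G_a), P)`; in particular
`SYN_BC3 · SYN_C3N · SYN_ACK_NC4 · SYN_ACK_C4B · ACK_BC3 ∈ M_TM1`.  Hence a For-all
attack against Threat Model 1 exists in this setup. -/
theorem stmt14 :
    (∃ K : Set (List Ev), K.Nonempty ∧ K ⊆ MTM1 ∧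
      IsControllable K Lang ATTKᶜ ∧
      IsNormalLang K Lang P) ∧
    ([.bc3 .syn, .c3n .syn, .nc4 .synack, .c4b .synack, .bc3 .ack] : List Ev) ∈ MTM1 := by
  exact ⟨⟨echoLang, echoLang_nonempty, fun _ hs => hs.1, isControllable_echoLang,
    isNormalLang_echoLang⟩, synack_injection_mem_MTM1⟩
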